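/- Let m, n be positive integers. For every b ∈ ℝ^m, the set { A ∈ M_{m,n}(ℝ) : ⟨A,b⟩ is badly approximable } has Lebesgue measure zero in M_{m,n}(ℝ) (identified with ℝ^{mn}). -/

import Mathlib

open MeasureTheory Filter

noncomputable section

/-- The vector of real entries of an integer vector. -/
def intCast {k : ℕ} (q : Fin k → ℤ) : Fin k → ℝ := fun i => (q i : ℝ)

/-- The value `Aq + b + p` of the system of affine forms `⟨A, b⟩` at `q`, shifted by `p`. -/
def affForm {m n : ℕ} (A : Fin m → Fin n → ℝ) (b : Fin m → ℝ)
    (q : Fin n → ℤ) (p : Fin m → ℤ) : Fin m → ℝ :=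
  fun i => (∑ j, A i j * (q j : ℝ)) + b i + (p i : ℝ)

/-- The system of affine forms `⟨A, b⟩` is badly approximable. -/
def IsBadlyApproximable {m n : ℕ} (A : Fin m → Fin n → ℝ) (b : Fin m → ℝ) : Prop :=
  ∃ c > (0 : ℝ), ∃ T : ℝ, ∀ p : Fin m → ℤ, ∀ q : Fin n → ℤ,
    T ≤ ‖intCast q‖ → c ≤ ‖affForm A b q p‖ ^ m * ‖intCast q‖ ^ n

open scoped Nat

theorem exists_int_abs_sub_add_lt {x y N : ℝ} (hN : 0 < N)
    (h : ⌊N * Int.fract x⌋ = ⌊N * Int.fract y⌋) : ∃ p : ℤ, |x - y + p| < 1 / N := by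
  refine ⟨⌊y⌋ - ⌊x⌋, ?_⟩
  have h1 := Int.abs_sub_lt_one_of_floor_eq_floor h
  rw [← mul_sub, abs_mul, abs_of_pos hN] at h1
  rw [lt_div_iff₀ hN, mul_comm]
  have h2 : x - y + ((⌊y⌋ - ⌊x⌋ : ℤ) : ℝ) = Int.fract x - Int.fract y := by
    push_cast
    rw [← Int.self_sub_floor, ← Int.self_sub_floor]
    ring
  rwa [h2]

/-- If the homogeneous system given by `A` has no small nonzero solution at scale `t`, then every
inhomogeneous system `⟨A, b⟩` has a solution at a comparable scale. -/
theorem exists_abs_affForm_lt {m n : ℕ} (A : Fin m → Fin n → ℝ) (b : Fin m → ℝ)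
    {L t : ℕ} (hL : 0 < L) (ht : 0 < t)
    (hA : ∀ q : Fin n → ℤ, q ≠ 0 → (∀ j, |q j| < t ^ m) → ∀ p : Fin m → ℤ,
      ¬ ∀ i, |(∑ j, A i j * q j) + p i| < 1 / (L * t ^ n)) :
    ∃ (q : Fin n → ℤ) (p : Fin m → ℤ),
      (∀ j, ((L ^ m)! * t ^ m : ℤ) ≤ q j ∧ q j ≤ 3 * ((L ^ m)! * t ^ m : ℤ)) ∧
      ∀ i, |affForm A b q p i| < (L ^ m)! / (L * t ^ n) := by
  set F : ℕ := (L ^ m)!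
  have hF0 : (0 : ℝ) < F := by exact_mod_cast Nat.factorial_pos _
  have hN : (0 : ℝ) < L * t ^ n := by positivity
  let v : ℤ := 2 * (F * t ^ m)
  let β : Fin m → ℝ := fun i => (b i + ∑ j, A i j * v) / F
  let g : Fin (L ^ m + 1) × (Fin n → Fin (t ^ m)) → Fin m → ℝ :=
    fun x i => (∑ j, A i j * ((x.2 j : ℕ) : ℝ)) + ((x.1 : ℕ) : ℝ) * β i
  have hlt : ∀ x i, ⌊(L * t ^ n : ℝ) * Int.fract (g x i)⌋.toNat < L * t ^ n := by
    intro x i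
    have h0 : 0 ≤ ⌊(L * t ^ n : ℝ) * Int.fract (g x i)⌋ :=
      Int.floor_nonneg.2 (mul_nonneg hN.le (Int.fract_nonneg _))
    have h1 : ⌊(L * t ^ n : ℝ) * Int.fract (g x i)⌋ < (L * t ^ n : ℕ) := by
      rw [Int.floor_lt]
      push_cast
      nlinarith [Int.fract_lt_one (g x i)]
    omega
  let f : Fin (L ^ m + 1) × (Fin n → Fin (t ^ m)) → Fin m → Fin (L * t ^ n) :=
    fun x i => ⟨_, hlt x i⟩
  have hcard : Fintype.card (Fin m → Fin (L * t ^ n)) <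
      Fintype.card (Fin (L ^ m + 1) × (Fin n → Fin (t ^ m))) := by
    simp only [Fintype.card_pi, Fintype.card_fin, Finset.prod_const, Finset.card_univ,
      Fintype.card_prod]
    have : 0 < t ^ (m * n) := by positivity
    rw [mul_pow, ← pow_mul, ← pow_mul, mul_comm n m, add_mul]
    omega
  obtain ⟨x, y, hxy, hfxy⟩ := Fintype.exists_ne_map_eq_of_card_lt f hcard
  wlog hle : (y.1 : ℕ) ≤ x.1 generalizing x y
  · exact this y x hxy.symm hfxy.symm (by omega)
  have hp : ∀ i, ∃ p : ℤ, |g x i - g y i + p| < 1 / (L * t ^ n) := by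
    intro i
    apply exists_int_abs_sub_add_lt hN
    have h0 : ∀ x, 0 ≤ ⌊(L * t ^ n : ℝ) * Int.fract (g x i)⌋ := fun x =>
      Int.floor_nonneg.2 (mul_nonneg hN.le (Int.fract_nonneg _))
    have h1 := congrArg Fin.val (congrFun hfxy i)
    simp only [f] at h1
    have := h0 x
    have := h0 y
    omega
  choose p hp using hp
  let u : Fin n → ℤ := fun j => ((x.2 j : ℕ) : ℤ) - ((y.2 j : ℕ) : ℤ)
  have hu : ∀ j, |u j| < t ^ m := by
    intro j
    have h1 : ((x.2 j : ℕ) : ℤ) < t ^ m := by exact_mod_cast (x.2 j).2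
    have h2 : ((y.2 j : ℕ) : ℤ) < t ^ m := by exact_mod_cast (y.2 j).2
    rw [abs_lt]
    constructor <;> simp only [u] <;> omega
  obtain ⟨k, hk⟩ := Nat.exists_eq_add_of_le hle
  have hg : ∀ i, g x i - g y i = (∑ j, A i j * (u j : ℝ)) + k * β i := by
    intro i
    simp only [g, u, hk]
    push_cast
    simp only [mul_sub, Finset.sum_sub_distrib]
    ring
  rcases Nat.eq_zero_or_pos k with rfl | hk0
  · exfalso
    refine hA u ?_ hu p fun i => ?_
    · intro hu0
      apply hxy
      refine Prod.ext (Fin.ext (by omega)) (funext fun j => Fin.ext ?_)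
      have := congrFun hu0 j
      simp only [u, Pi.zero_apply] at this
      omega
    · have := hp i
      rw [hg] at this
      simpa using this
  · have hkL : k ≤ L ^ m := by have := x.1.2; omega
    obtain ⟨d, hd⟩ : k ∣ F := Nat.dvd_factorial hk0 hkL
    have hFpos : 0 < F := Nat.factorial_pos _
    have hd0 : 0 < d := Nat.pos_of_ne_zero (by rintro rfl; omega)
    have hdF : d ≤ F := Nat.le_of_dvd hFpos ⟨k, by rw [hd, mul_comm]⟩
    refine ⟨fun j => d * u j + v, fun i => d * p i, fun j => ?_, fun i => ?_⟩
    · have h1 : |(d : ℤ) * u j| ≤ F * t ^ m := by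
        rw [abs_mul, Nat.abs_cast]
        exact mul_le_mul (by exact_mod_cast hdF) (hu j).le (abs_nonneg _) (by positivity)
      rw [abs_le] at h1
      simp only [v]
      constructor <;> linarith [h1.1, h1.2]
    · have h1 : affForm A b (fun j => d * u j + v) (fun i => d * p i) i =
          d * (g x i - g y i + p i) := by
        have hβ : (d : ℝ) * (k * β i) = b i + ∑ j, A i j * v := by
          simp only [β]
          rw [hd]
          have : (d : ℝ) ≠ 0 := by positivity
          have : (k : ℝ) ≠ 0 := by positivity
          push_cast
          field_simp
          exact congrArg _ (Finset.sum_congr rfl fun _ _ => mul_comm _ _)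
        rw [hg, mul_add, mul_add, hβ, affForm, Finset.mul_sum]
        push_cast
        simp only [mul_add, Finset.sum_add_distrib]
        have : ∀ j, A i j * (d * (u j : ℝ)) = d * (A i j * u j) := fun j => by ring
        simp only [this]
        ring
      rw [h1, abs_mul, Nat.abs_cast]
      calc (d : ℝ) * |g x i - g y i + p i| < d * (1 / (L * t ^ n)) :=
            mul_lt_mul_of_pos_left (hp i) (by exact_mod_cast hd0)
        _ ≤ F * (1 / (L * t ^ n)) := by gcongr
        _ = F / (L * t ^ n) := by ring

/-- Approximate solutions of an affine system are exact solutions of a nearby system. -/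
theorem exists_affForm_eq_zero {m n : ℕ} (A : Fin m → Fin n → ℝ) (b : Fin m → ℝ)
    {q : Fin n → ℤ} {p : Fin m → ℤ} {ε R : ℝ} (hR : 0 < R) (hε : 0 ≤ ε) {k : Fin n}
    (hq : R ≤ q k) (h : ∀ i, |affForm A b q p i| ≤ ε) :
    ∃ A' : Fin m → Fin n → ℝ, dist A A' ≤ ε / R ∧ affForm A' b q p = 0 := by
  have hqk : (0 : ℝ) < q k := hR.trans_le hq
  refine ⟨fun i j => A i j - if j = k then affForm A b q p i / q k else 0, ?_, ?_⟩
  · have h0 : 0 ≤ ε / R := by positivity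
    refine (dist_pi_le_iff h0).2 fun i => (dist_pi_le_iff h0).2 fun j => ?_
    rw [Real.dist_eq, sub_sub_cancel]
    split_ifs
    · rw [abs_div, abs_of_pos hqk]
      exact div_le_div₀ hε (h i) hR hq
    · simpa using h0
  · funext i
    simp only [affForm, sub_mul, Finset.sum_sub_distrib, ite_mul, zero_mul, Finset.sum_ite_eq',
      Finset.mem_univ, if_true, Pi.zero_apply]
    field_simp
    ring

theorem abs_affForm_le_of_affForm_eq_zero {m n : ℕ} {A A' : Fin m → Fin n → ℝ} {b : Fin m → ℝ}
    {q : Fin n → ℤ} {p : Fin m → ℤ} (h : affForm A' b q p = 0) (i : Fin m) :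
    |affForm A b q p i| ≤ n * (dist A A' * ‖intCast q‖) := by
  have h1 : affForm A b q p i = ∑ j, (A i j - A' i j) * q j := by
    have := congrFun h i
    simp only [affForm, Pi.zero_apply] at this
    simp only [affForm, sub_mul, Finset.sum_sub_distrib]
    linarith
  rw [h1]
  calc |∑ j, (A i j - A' i j) * (q j : ℝ)| ≤ ∑ j, |(A i j - A' i j) * (q j : ℝ)| :=
        Finset.abs_sum_le_sum_abs _ _
    _ ≤ ∑ _j : Fin n, dist A A' * ‖intCast q‖ := by
        refine Finset.sum_le_sum fun j _ => ?_
        rw [abs_mul, ← Real.dist_eq]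
        exact mul_le_mul ((dist_le_pi_dist (A i) (A' i) j).trans (dist_le_pi_dist A A' i))
          (norm_le_pi_norm (intCast q) j) (abs_nonneg _) dist_nonneg
    _ = n * (dist A A' * ‖intCast q‖) := by simp

/-- The value `A q` for a matrix `A` with entries in `ℝ ⧸ ℤ` and an integer vector `q`, as an additive
homomorphism in `A`. -/
def torusMulVec (m : ℕ) {n : ℕ} (q : Fin n → ℤ) :
    (Fin m → Fin n → UnitAddCircle) →+ (Fin m → UnitAddCircle) where
  toFun A i := ∑ j, q j • A i j
  map_zero' := by ext; simp
  map_add' A B := by ext; simp [Finset.sum_add_distrib]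

theorem torusMulVec_surjective (m : ℕ) {n : ℕ} {q : Fin n → ℤ} (hq : q ≠ 0) :
    Function.Surjective (torusMulVec m q) := by
  obtain ⟨k, hk⟩ := Function.ne_iff.1 hq
  have hk' : (q k : ℝ) ≠ 0 := by exact_mod_cast hk
  intro y
  have hy : ∀ i, ∃ x : UnitAddCircle, q k • x = y i := by
    intro i
    obtain ⟨r, hr⟩ := QuotientAddGroup.mk_surjective (y i)
    refine ⟨((r / q k : ℝ) : UnitAddCircle), ?_⟩
    rw [← AddCircle.coe_zsmul, zsmul_eq_mul, mul_div_cancel₀ _ hk']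
    exact hr
  choose x hx using hy
  refine ⟨fun i => Pi.single k (x i), funext fun i => ?_⟩
  change ∑ j, q j • (Pi.single k (x i) : Fin n → UnitAddCircle) j = y i
  rw [Finset.sum_eq_single k]
  · simpa using hx i
  · intro j _ hj
    simp [hj]
  · simp

theorem measurePreserving_torusMulVec (m : ℕ) {n : ℕ} {q : Fin n → ℤ} (hq : q ≠ 0) :
    MeasurePreserving (torusMulVec m q) volume volume := by
  have : (volume : Measure (Fin m → Fin n → UnitAddCircle)).IsAddHaarMeasure :=
    Measure.pi.isAddHaarMeasure _
  refine AddMonoidHom.measurePreserving ?_ (torusMulVec_surjective m hq) ?_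
  · change Continuous fun A : Fin m → Fin n → UnitAddCircle => fun i => ∑ j, q j • A i j
    fun_prop
  · simp [volume_pi, Measure.pi_univ]

theorem volume_torusMulVec_norm_lt_le (m : ℕ) {n : ℕ} {q : Fin n → ℤ} (hq : q ≠ 0)
    {ε : ℝ} (hε : 0 ≤ ε) :
    volume {A : Fin m → Fin n → UnitAddCircle | ∀ i, ‖torusMulVec m q A i‖ < ε} ≤
      ENNReal.ofReal (2 * ε) ^ m := by
  have hsub : {A : Fin m → Fin n → UnitAddCircle | ∀ i, ‖torusMulVec m q A i‖ < ε} ⊆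
      torusMulVec m q ⁻¹' Metric.closedBall 0 ε := fun A hA => by
    simpa [pi_norm_le_iff_of_nonneg hε] using fun i => (hA i).le
  refine (measure_mono hsub).trans ?_
  rw [(measurePreserving_torusMulVec m hq).measure_preimage
    Metric.isClosed_closedBall.measurableSet.nullMeasurableSet, volume_pi,
    Measure.pi_closedBall _ _ hε]
  calc ∏ i : Fin m, volume (Metric.closedBall ((0 : Fin m → UnitAddCircle) i) ε)
      ≤ ∏ _i : Fin m, ENNReal.ofReal (2 * ε) := by
        refine Finset.prod_le_prod' fun i _ => ?_
        rw [AddCircle.volume_closedBall]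
        exact ENNReal.ofReal_le_ofReal (min_le_right _ _)
    _ = _ := by simp

/-- The matrices over `ℝ ⧸ ℤ` having a small nonzero homogeneous solution at scale `t`. -/
def torusBad (m n L t : ℕ) : Set (Fin m → Fin n → UnitAddCircle) :=
  {A | ∃ q : Fin n → ℤ, q ≠ 0 ∧ (∀ j, |q j| < t ^ m) ∧
    ∀ i, ‖torusMulVec m q A i‖ < 1 / (L * t ^ n)}

theorem volume_torusBad_le (m n : ℕ) {L t : ℕ} (hL : 0 < L) (ht : 0 < t) :
    volume (torusBad m n L t) ≤ ENNReal.ofReal (2 ^ (n + m) / L ^ m) := by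
  classical
  let S : Finset (Fin n → ℤ) :=
    (Fintype.piFinset fun _ : Fin n => Finset.Ioo (-(t ^ m : ℤ)) (t ^ m)).filter (· ≠ 0)
  have hS : (S.card : ℝ) ≤ (2 * t ^ m) ^ n := by
    have h1 : S.card ≤ (2 * t ^ m) ^ n := by
      refine (Finset.card_filter_le _ _).trans ?_
      rw [Fintype.card_piFinset, Finset.prod_const, Finset.card_univ, Fintype.card_fin,
        Int.card_Ioo]
      refine Nat.pow_le_pow_left ?_ n
      zify
      rw [Int.toNat_of_nonneg (by have : (0 : ℤ) < t ^ m := by positivity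
                                  omega)]
      omega
    exact_mod_cast h1
  have hε : (0 : ℝ) ≤ 1 / (L * t ^ n) := by positivity
  have hsub : torusBad m n L t ⊆ ⋃ q ∈ S, {A | ∀ i, ‖torusMulVec m q A i‖ < 1 / (L * t ^ n)} := by
    rintro A ⟨q, hq0, hq, hA⟩
    refine Set.mem_biUnion (x := q) ?_ hA
    simp only [S, Finset.coe_filter, Fintype.mem_piFinset, Finset.mem_Ioo, Set.mem_ofPred_eq]
    exact ⟨fun j => abs_lt.1 (hq j), hq0⟩
  calc volume (torusBad m n L t)
      ≤ ∑ q ∈ S, volume {A | ∀ i, ‖torusMulVec m q A i‖ < 1 / (L * t ^ n)} :=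
        (measure_mono hsub).trans (measure_biUnion_finset_le _ _)
    _ ≤ ∑ _q ∈ S, ENNReal.ofReal (2 * (1 / (L * t ^ n))) ^ m :=
        Finset.sum_le_sum fun q hq =>
          volume_torusMulVec_norm_lt_le m (Finset.mem_filter.1 hq).2 hε
    _ = ENNReal.ofReal (S.card * (2 * (1 / (L * t ^ n))) ^ m) := by
        rw [Finset.sum_const, nsmul_eq_mul, ENNReal.ofReal_mul (Nat.cast_nonneg _),
          ENNReal.ofReal_natCast, ENNReal.ofReal_pow (by positivity)]
    _ ≤ ENNReal.ofReal (2 ^ (n + m) / L ^ m) := by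
        refine ENNReal.ofReal_le_ofReal ?_
        calc (S.card : ℝ) * (2 * (1 / (L * t ^ n))) ^ m
            ≤ (2 * t ^ m) ^ n * (2 * (1 / (L * t ^ n))) ^ m := by gcongr
          _ = 2 ^ (n + m) / L ^ m := by
            have : (t : ℝ) ≠ 0 := by positivity
            have : (L : ℝ) ≠ 0 := by positivity
            simp only [mul_pow, div_pow, one_pow, ← pow_mul, pow_add]
            rw [mul_comm n m]
            field_simp

/-- Almost every matrix is nonsingular, in the sense that for some `L` it has no small homogeneous
solutions at infinitely many scales. -/
theorem ae_frequently_notMem_torusBad (m n : ℕ) (hm : 0 < m) :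
    ∀ᵐ A : Fin m → Fin n → UnitAddCircle, ∃ L : ℕ, 0 < L ∧ ∃ᶠ t in atTop, A ∉ torusBad m n L t := by
  rw [ae_iff]
  have hlim : Tendsto (fun L : ℕ => ENNReal.ofReal (2 ^ (n + m) / (L : ℝ) ^ m)) atTop (nhds 0) := by
    rw [← ENNReal.ofReal_zero]
    refine ENNReal.tendsto_ofReal (Tendsto.const_div_atTop ?_ _)
    exact (tendsto_pow_atTop hm.ne').comp tendsto_natCast_atTop_atTop
  refine le_antisymm (ge_of_tendsto hlim ?_) zero_le
  filter_upwards [eventually_gt_atTop 0] with L hL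
  have hsub : {A : Fin m → Fin n → UnitAddCircle |
      ¬ ∃ L : ℕ, 0 < L ∧ ∃ᶠ t in atTop, A ∉ torusBad m n L t} ⊆
      ⋃ T : ℕ, ⋂ t ≥ T, torusBad m n L t := by
    intro A hA
    have h1 : ¬ ∃ᶠ t in atTop, A ∉ torusBad m n L t := fun h => hA ⟨L, hL, h⟩
    rw [not_frequently] at h1
    obtain ⟨T, hT⟩ := eventually_atTop.1 h1
    exact Set.mem_iUnion.2 ⟨T, Set.mem_iInter₂.2 fun t ht => not_not.1 (hT t ht)⟩
  have hmono : Monotone fun T : ℕ => ⋂ t ≥ T, torusBad m n L t := fun T T' hTT' =>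
    Set.biInter_subset_biInter_left fun t (ht : T' ≤ t) => hTT'.trans ht
  refine (measure_mono hsub).trans ?_
  rw [hmono.measure_iUnion]
  refine iSup_le fun T => ?_
  exact (measure_mono (Set.biInter_subset_of_mem (show T + 1 ≥ T by omega))).trans
    (volume_torusBad_le m n hL T.succ_pos)

/-- A property holding almost everywhere on the torus holds almost everywhere after lifting. -/
theorem ae_of_ae_torus {m n : ℕ} {P : (Fin m → Fin n → UnitAddCircle) → Prop}
    (h : ∀ᵐ A, P A) : ∀ᵐ A : Fin m → Fin n → ℝ, P fun i j => (A i j : UnitAddCircle) := by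
  let s : (Fin m → Fin n → ℤ) → Set (Fin m → Fin n → ℝ) := fun z =>
    Set.univ.pi fun i => Set.univ.pi fun j => Set.Ioc (z i j : ℝ) (z i j + 1)
  have hs : ⋃ z, s z = Set.univ := by
    refine Set.eq_univ_of_forall fun A => Set.mem_iUnion.2 ⟨fun i j => ⌈A i j⌉ - 1, ?_⟩
    intro i _ j _
    simp only [Int.cast_sub, Int.cast_one, sub_add_cancel]
    exact ⟨by linarith [Int.ceil_lt_add_one (A i j)], Int.le_ceil _⟩
  rw [← Measure.restrict_univ (μ := (volume : Measure (Fin m → Fin n → ℝ))), ← hs,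
    ae_restrict_iUnion_iff]
  intro z
  have hmp : MeasurePreserving
      (fun (A : Fin m → Fin n → ℝ) i j => (A i j : UnitAddCircle)) (volume.restrict (s z)) volume := by
    simp only [s, volume_pi, Measure.restrict_pi_pi]
    refine measurePreserving_pi _ _ (f := fun _ (a : Fin n → ℝ) j => (a j : UnitAddCircle))
      fun i => ?_
    refine measurePreserving_pi _ _ (f := fun _ (a : ℝ) => (a : UnitAddCircle)) fun j => ?_
    exact UnitAddCircle.measurePreserving_mk _
  exact hmp.quasiMeasurePreserving.ae h

theorem norm_torusMulVec_le {m n : ℕ} (A : Fin m → Fin n → ℝ) (q : Fin n → ℤ) (i : Fin m) (p : ℤ) :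
    ‖torusMulVec m q (fun i j => (A i j : UnitAddCircle)) i‖ ≤ |(∑ j, A i j * q j) + p| := by
  have h1 : torusMulVec m q (fun i j => (A i j : UnitAddCircle)) i =
      ((∑ j, A i j * q j : ℝ) : UnitAddCircle) := by
    change ∑ j, q j • ((A i j : ℝ) : UnitAddCircle) = _
    change _ = QuotientAddGroup.mk' _ (∑ j, A i j * (q j : ℝ))
    rw [map_sum]
    refine Finset.sum_congr rfl fun j _ => ?_
    rw [mul_comm, ← zsmul_eq_mul]
    exact (AddCircle.coe_zsmul ..).symm
  rw [h1, UnitAddCircle.norm_eq]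
  simpa using round_le (∑ j, A i j * (q j : ℝ)) (-p)

/-- By the Cassels lemma, almost every matrix is, at infinitely many scales, within any prescribed
multiple of the critical distance of a matrix whose affine system has an exact solution. -/
theorem ae_frequently_exists_affForm_eq_zero {m n : ℕ} (hm : 0 < m) (hn : 0 < n) (b : Fin m → ℝ) :
    ∀ᵐ A : Fin m → Fin n → ℝ, ∃ F : ℕ, 0 < F ∧ ∀ k : ℕ, ∃ᶠ t : ℕ in atTop,
      ∃ (q : Fin n → ℤ) (p : Fin m → ℤ), (∀ j, (F * t ^ m : ℤ) ≤ q j ∧ q j ≤ 3 * (F * t ^ m : ℤ)) ∧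
        ∃ A', affForm A' b q p = 0 ∧ dist A A' < 1 / (k + 1) * (1 / t) ^ (m + n) := by
  let s : ℕ → ℕ → Set (Fin m → Fin n → ℝ) := fun F t => {A | ∃ (q : Fin n → ℤ) (p : Fin m → ℤ),
    (∀ j, (F * t ^ m : ℤ) ≤ q j ∧ q j ≤ 3 * (F * t ^ m : ℤ)) ∧ affForm A b q p = 0}
  let r : ℕ → ℝ := fun t => (1 / t) ^ (m + n)
  have hr : Tendsto r atTop (nhds 0) := by
    have := (tendsto_one_div_atTop_nhds_zero_nat (𝕜 := ℝ)).pow (m + n)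
    rwa [zero_pow (by omega)] at this
  have hae : ∀ᵐ A : Fin m → Fin n → ℝ, ∀ F k : ℕ,
      A ∈ limsup (fun t => Metric.thickening (2 * r t) (s F t)) atTop →
      A ∈ limsup (fun t => Metric.thickening (1 / (k + 1) * r t) (s F t)) atTop := by
    rw [ae_all_iff]
    intro F
    rw [ae_all_iff]
    intro k
    have h1 := blimsup_thickening_mul_ae_eq (volume : Measure (Fin m → Fin n → ℝ))
      (fun _ => True) (s F) two_pos r hr
    have h2 := blimsup_thickening_mul_ae_eq (volume : Measure (Fin m → Fin n → ℝ))
      (fun _ => True) (s F) (M := 1 / ((k : ℝ) + 1)) (by positivity) r hr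
    simp only [blimsup_true] at h1 h2
    exact (h1.trans h2.symm).mem_iff.mono fun A hA => hA.1
  filter_upwards [hae, ae_of_ae_torus (ae_frequently_notMem_torusBad m n hm)]
    with A hA ⟨L, hL, hfreq⟩
  have hF : 0 < (L ^ m)! := Nat.factorial_pos _
  refine ⟨(L ^ m)!, hF, fun k => ?_⟩
  have h1 : A ∈ limsup (fun t => Metric.thickening (2 * r t) (s (L ^ m)! t)) atTop := by
    rw [mem_limsup_iff_frequently_mem]
    refine (hfreq.and_eventually (eventually_gt_atTop 0)).mono ?_
    rintro t ⟨hbad, ht⟩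
    obtain ⟨q, p, hq, hp⟩ := exists_abs_affForm_lt A b hL ht fun q hq0 hq p hp =>
      hbad ⟨q, hq0, hq, fun i => (norm_torusMulVec_le A q i (p i)).trans_lt (hp i)⟩
    obtain ⟨A', hAA', hA'⟩ := exists_affForm_eq_zero A b (R := (L ^ m)! * t ^ m) (k := ⟨0, hn⟩)
      (by positivity) (by positivity) (by exact_mod_cast (hq ⟨0, hn⟩).1) fun i => (hp i).le
    refine Metric.mem_thickening_iff.2 ⟨A', ⟨q, p, hq, hA'⟩, hAA'.trans_lt ?_⟩
    have ht' : (0 : ℝ) < t := by exact_mod_cast ht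
    have hL' : (1 : ℝ) ≤ L := by exact_mod_cast hL
    have hF' : (0 : ℝ) < (L ^ m)! := by exact_mod_cast hF
    have hrt : 0 < r t := by simp only [r]; positivity
    calc ((L ^ m)! : ℝ) / (L * t ^ n) / ((L ^ m)! * t ^ m) = 1 / L * r t := by
          simp only [r, one_div, inv_pow, pow_add]
          field_simp
      _ ≤ 1 * r t := by
          gcongr
          exact (div_le_one (by positivity)).2 hL'
      _ < 2 * r t := by linarith
  have h2 := hA _ k h1
  rw [mem_limsup_iff_frequently_mem] at h2
  refine h2.mono fun t ht => ?_
  obtain ⟨B, ⟨q, p, hq, hB⟩, hd⟩ := Metric.mem_thickening_iff.1 ht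
  exact ⟨q, p, hq, B, hB, hd⟩

/-- Singly metric statement: for every `b ∈ ℝ^m`, the set of `A ∈ M_{m,n}(ℝ)` with
`⟨A, b⟩` badly approximable has Lebesgue measure zero. -/
theorem badly_approximable_slice_measure_zero (m n : ℕ) (hm : 0 < m) (hn : 0 < n)
    (b : Fin m → ℝ) :
    volume {A : Fin m → Fin n → ℝ | IsBadlyApproximable A b} = 0 := by
  refine measure_mono_null ?_ (ae_iff.1 (ae_frequently_exists_affForm_eq_zero hm hn b))
  rintro A ⟨c, hc, T, hbad⟩ ⟨F, hF, hfreq⟩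
  have hF' : (0 : ℝ) < F := by exact_mod_cast hF
  have hlim : Tendsto (fun k : ℕ => (n * (1 / ((k : ℝ) + 1) * (3 * F))) ^ m * (3 * F) ^ n)
      atTop (nhds 0) := by
    have := ((((tendsto_one_div_add_atTop_nhds_zero_nat (𝕜 := ℝ)).mul_const
      (3 * (F : ℝ))).const_mul (n : ℝ)).pow m).mul_const ((3 * (F : ℝ)) ^ n)
    simpa [hm.ne'] using this
  obtain ⟨k, hk⟩ := (hlim.eventually_lt_const hc).exists
  have hT : ∀ᶠ t : ℕ in atTop, T ≤ t := tendsto_natCast_atTop_atTop.eventually_ge_atTop T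
  obtain ⟨t, ⟨q, p, hq, A', hA', hd⟩, hTt, ht⟩ :=
    ((hfreq k).and_eventually (hT.and (eventually_gt_atTop 0))).exists
  have ht' : (0 : ℝ) < t := by exact_mod_cast ht
  have hqn : ‖intCast q‖ ≤ 3 * F * t ^ m := by
    refine (pi_norm_le_iff_of_nonneg (by positivity)).2 fun j => ?_
    have h1 : (F * t ^ m : ℝ) ≤ q j := by exact_mod_cast (hq j).1
    have h2 : (q j : ℝ) ≤ 3 * (F * t ^ m : ℝ) := by exact_mod_cast (hq j).2
    have h3 : (0 : ℝ) ≤ F * t ^ m := by positivity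
    rw [Real.norm_eq_abs, intCast, abs_of_nonneg (h3.trans h1)]
    linarith
  have hTq : T ≤ ‖intCast q‖ := by
    have h1 : t ≤ F * t ^ m :=
      (Nat.le_self_pow hm.ne' t).trans (Nat.le_mul_of_pos_left _ hF)
    have h2 : (t : ℤ) ≤ q ⟨0, hn⟩ := le_trans (by exact_mod_cast h1) (hq ⟨0, hn⟩).1
    calc T ≤ t := hTt
      _ ≤ q ⟨0, hn⟩ := by exact_mod_cast h2
      _ ≤ ‖intCast q ⟨0, hn⟩‖ := le_abs_self _
      _ ≤ _ := norm_le_pi_norm _ _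
  have haff : ‖affForm A b q p‖ ≤ n * (1 / ((k : ℝ) + 1) * (3 * F)) * (1 / t) ^ n := by
    refine (pi_norm_le_iff_of_nonneg (by positivity)).2 fun i => ?_
    calc ‖affForm A b q p i‖ ≤ n * (dist A A' * ‖intCast q‖) :=
          abs_affForm_le_of_affForm_eq_zero hA' i
      _ ≤ n * ((1 / (k + 1) * (1 / t) ^ (m + n)) * (3 * F * t ^ m)) := by gcongr
      _ = _ := by
          simp only [one_div, inv_pow, pow_add]
          field_simp
  refine (hbad p q hTq).not_gt ?_
  calc ‖affForm A b q p‖ ^ m * ‖intCast q‖ ^ n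
      ≤ (n * (1 / ((k : ℝ) + 1) * (3 * F)) * (1 / t) ^ n) ^ m * (3 * F * t ^ m) ^ n := by gcongr
    _ = (n * (1 / ((k : ℝ) + 1) * (3 * F))) ^ m * (3 * F) ^ n := by
        rw [mul_pow _ ((1 / (t : ℝ)) ^ n), mul_pow _ ((t : ℝ) ^ m), ← pow_mul, ← pow_mul,
          mul_comm m n, one_div_pow]
        field_simp
    _ < c := hk
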